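/- arXiv:2208.11323 — 2 statements merged into one kernel-verified Lean document; each statement's English description precedes it below -/
import Mathlib

section
/- Let f be a finite nonnegative Borel measure on ℝ and let 0 < t₁ ≤ t₂. Then liminf_{N→∞} (N/log N) · V_N ≥ t₁ · f(ℝ), where V_N := N^{−2} ∫_{[0,N]²} ∫_0^{t₁} ∫_ℝ p_{2s(τ−s)/τ}((s/τ)(τ₂x₂ − τ₁x₁) − y) f(dy) ds dx₁ dx₂. -/
open MeasureTheory

/-- One-dimensional heat kernel `p_t(x) = (2πt)^{-1/2} exp(-x²/(2t))`. -/
noncomputable def heat1 (t x : ℝ) : ℝ :=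
  (2 * Real.pi * t) ^ (-(1 : ℝ) / 2) * Real.exp (-x ^ 2 / (2 * t))

/-- `V_N = N⁻² ∫_{[0,N]²} ∫_0^{t₁} ∫_ℝ p_{2s(τ-s)/τ}((s/τ)(τ₂x₂ - τ₁x₁) - y) f(dy) ds dx₁ dx₂`
with `τ = 2t₁t₂/(t₁+t₂)`, `τ₁ = 2t₂/(t₁+t₂)`, `τ₂ = 2t₁/(t₁+t₂)`. -/
noncomputable def VN (f : Measure ℝ) (t₁ t₂ N : ℝ) : ℝ :=
  let τ := 2 * t₁ * t₂ / (t₁ + t₂)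
  let τ₁ := 2 * t₂ / (t₁ + t₂)
  let τ₂ := 2 * t₁ / (t₁ + t₂)
  (N ^ 2)⁻¹ * ∫ x₁ in Set.Icc (0 : ℝ) N, ∫ x₂ in Set.Icc (0 : ℝ) N,
    ∫ s in Set.Ioo (0 : ℝ) t₁,
      ∫ y, heat1 (2 * s * (τ - s) / τ) ((s / τ) * (τ₂ * x₂ - τ₁ * x₁) - y) ∂f


open Filter Topology ProbabilityTheory

theorem measurable_heat1 : Measurable (fun p : ℝ × ℝ => heat1 p.1 p.2) := by
  unfold heat1
  fun_prop

theorem heat1_nonneg {t : ℝ} (ht : 0 ≤ t) (x : ℝ) : 0 ≤ heat1 t x := by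
  unfold heat1
  positivity

theorem heat1_le_rpow {s t : ℝ} (hs : 0 < s) (hst : s ≤ t) (x : ℝ) :
    heat1 t x ≤ s ^ (-(1 : ℝ) / 2) := by
  have ht : 0 < t := hs.trans_le hst
  have hexp : Real.exp (-x ^ 2 / (2 * t)) ≤ 1 := by
    rw [Real.exp_le_one_iff, neg_div, neg_nonpos]
    positivity
  have hpi : s ≤ 2 * Real.pi * t := by nlinarith [Real.pi_gt_three]
  calc heat1 t x ≤ (2 * Real.pi * t) ^ (-(1 : ℝ) / 2) * 1 := by
        unfold heat1
        gcongr
    _ ≤ s ^ (-(1 : ℝ) / 2) := by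
        rw [mul_one]
        exact Real.rpow_le_rpow_of_nonpos hs hpi (by norm_num)

theorem heat1_affine_eq_gaussianPDFReal {v a : ℝ} (hv : 0 < v) (ha : 0 < a) (b x : ℝ) :
    heat1 v (a * x - b) = a⁻¹ * gaussianPDFReal (b / a) (v / a ^ 2).toNNReal x := by
  have hpos : 0 ≤ 2 * Real.pi * v := by positivity
  unfold heat1 gaussianPDFReal
  rw [Real.coe_toNNReal _ (by positivity), ← mul_div_assoc, Real.sqrt_div hpos,
    Real.sqrt_sq ha.le, neg_div, Real.rpow_neg hpos, ← Real.sqrt_eq_rpow, inv_div,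
    div_eq_mul_inv a, ← mul_assoc, inv_mul_cancel_left₀ ha.ne']
  congr 2
  field_simp

theorem setLIntegral_heat1_affine {v a : ℝ} (hv : 0 < v) (ha : 0 < a) (b : ℝ) (S : Set ℝ) :
    ∫⁻ x in S, ENNReal.ofReal (heat1 v (a * x - b)) =
      ENNReal.ofReal a⁻¹ * gaussianReal (b / a) (v / a ^ 2).toNNReal S := by
  have hv' : (v / a ^ 2).toNNReal ≠ 0 := by
    rw [Ne, Real.toNNReal_eq_zero, not_le]
    positivity
  rw [gaussianReal_apply _ hv', ← lintegral_const_mul _ (measurable_gaussianPDF _ _)]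
  simp_rw [heat1_affine_eq_gaussianPDFReal hv ha, gaussianPDF,
    ENNReal.ofReal_mul (inv_nonneg.2 ha.le)]

theorem one_sub_le_gaussianReal {m r δ : ℝ} {v : NNReal} {S : Set ℝ} (hr : 0 < r)
    (hv : (v : ℝ) ≤ δ * r ^ 2) (hS : ∀ x, |x - m| < r → x ∈ S) :
    ENNReal.ofReal (1 - δ) ≤ gaussianReal m v S := by
  have hcheb := meas_ge_le_variance_div_sq (memLp_id_gaussianReal (μ := m) (v := v) 2) hr
  simp only [id_eq, integral_id_gaussianReal, variance_id_gaussianReal] at hcheb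
  have hset : MeasurableSet {x : ℝ | r ≤ |x - m|} :=
    measurableSet_le measurable_const (by fun_prop)
  have hcompl : {x : ℝ | r ≤ |x - m|}ᶜ ⊆ S := fun x hx => hS x (not_le.1 hx)
  refine le_trans ?_ (measure_mono hcompl)
  rw [prob_compl_eq_one_sub hset]
  have hδ : 0 ≤ δ := by
    by_contra! h
    nlinarith [v.coe_nonneg, sq_pos_of_pos hr]
  rw [ENNReal.ofReal_sub _ hδ, ENNReal.ofReal_one]
  refine tsub_le_tsub_left (hcheb.trans (ENNReal.ofReal_le_ofReal ?_)) _
  rwa [div_le_iff₀ (by positivity)]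

theorem integral_integral_integral_integral_eq_toReal_lintegral
    {α β γ ι : Type*} [MeasurableSpace α] [MeasurableSpace β] [MeasurableSpace γ]
    [MeasurableSpace ι] {μ : Measure α} {ν : Measure β} {ρ : Measure γ} {κ : Measure ι}
    [SFinite μ] [SFinite ν] [SFinite ρ] [SFinite κ] {F : α × β × γ × ι → ℝ}
    (hF : Measurable F) (h0 : 0 ≤ᵐ[μ.prod (ν.prod (ρ.prod κ))] F)
    (hfin : ∫⁻ p, ENNReal.ofReal (F p) ∂(μ.prod (ν.prod (ρ.prod κ))) ≠ ⊤) :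
    ∫ a, ∫ b, ∫ c, ∫ d, F (a, b, c, d) ∂κ ∂ρ ∂ν ∂μ =
      (∫⁻ p, ENNReal.ofReal (F p) ∂(μ.prod (ν.prod (ρ.prod κ)))).toReal := by
  have hint : Integrable F (μ.prod (ν.prod (ρ.prod κ))) :=
    (lintegral_ofReal_ne_top_iff_integrable hF.aestronglyMeasurable h0).1 hfin
  rw [← integral_eq_lintegral_of_nonneg_ae h0 hF.aestronglyMeasurable, integral_prod _ hint]
  refine integral_congr_ae ?_
  filter_upwards [hint.prod_right_ae] with a ha
  rw [integral_prod _ ha]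
  refine integral_congr_ae ?_
  filter_upwards [ha.prod_right_ae] with b hb
  rw [integral_prod _ hb]

theorem lintegral_prod_prod_prod_reorder
    {α β γ ι : Type*} [MeasurableSpace α] [MeasurableSpace β] [MeasurableSpace γ]
    [MeasurableSpace ι] {μ : Measure α} {ν : Measure β} {ρ : Measure γ} {κ : Measure ι}
    [SFinite μ] [SFinite ν] [SFinite ρ] [SFinite κ] {F : α × β × γ × ι → ENNReal}
    (hF : Measurable F) :
    ∫⁻ p, F p ∂(μ.prod (ν.prod (ρ.prod κ))) =
      ∫⁻ c, ∫⁻ d, ∫⁻ a, ∫⁻ b, F (a, b, c, d) ∂ν ∂μ ∂κ ∂ρ := by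
  have hG : Measurable fun q : (γ × ι) × α × β => F (q.2.1, q.2.2, q.1.1, q.1.2) := by fun_prop
  rw [lintegral_prod _ hF.aemeasurable]
  calc ∫⁻ a, ∫⁻ q, F (a, q) ∂(ν.prod (ρ.prod κ)) ∂μ
      = ∫⁻ a, ∫⁻ q, ∫⁻ b, F (a, b, q) ∂ν ∂(ρ.prod κ) ∂μ := by
        refine lintegral_congr fun a => ?_
        rw [lintegral_prod_symm _ (by fun_prop)]
    _ = ∫⁻ q, ∫⁻ a, ∫⁻ b, F (a, b, q) ∂ν ∂μ ∂(ρ.prod κ) := by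
        rw [lintegral_lintegral_swap]
        exact (Measurable.lintegral_prod_right'
          (f := fun z : (α × γ × ι) × β => F (z.1.1, z.2, z.1.2)) (by fun_prop)).aemeasurable
    _ = _ := by
        rw [lintegral_prod]
        refine (Measurable.lintegral_prod_right'
          (f := fun z : (γ × ι) × α => ∫⁻ b, F (z.2, b, z.1) ∂ν) ?_).aemeasurable
        exact Measurable.lintegral_prod_right'
          (f := fun z : ((γ × ι) × α) × β => F (z.1.2, z.2, z.1.1)) (by fun_prop)

/-- The variance `2s(τ-s)/τ`, with `τ` the harmonic mean of `t₁` and `t₂`. -/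
noncomputable def bridgeVar (t₁ t₂ s : ℝ) : ℝ :=
  2 * s * (2 * t₁ * t₂ / (t₁ + t₂) - s) / (2 * t₁ * t₂ / (t₁ + t₂))

/-- The quadruple integral in `VN`, as a lower Lebesgue integral with the spatial variables
integrated first. -/
noncomputable def lintegralVN (f : Measure ℝ) (t₁ t₂ N : ℝ) : ENNReal :=
  ∫⁻ s in Set.Ioo 0 t₁, ∫⁻ y, (∫⁻ x₁ in Set.Icc 0 N, ∫⁻ x₂ in Set.Icc 0 N,
    ENNReal.ofReal (heat1 (bridgeVar t₁ t₂ s) (s / t₂ * x₂ - (s / t₁ * x₁ + y)))) ∂f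

section bridgeVar

variable {t₁ t₂ s : ℝ}

theorem le_harmonicMean (h1 : 0 < t₁) (h12 : t₁ ≤ t₂) : t₁ ≤ 2 * t₁ * t₂ / (t₁ + t₂) := by
  rw [le_div_iff₀ (by linarith)]
  nlinarith

theorem bridgeVar_pos (h1 : 0 < t₁) (h12 : t₁ ≤ t₂) (hs : s ∈ Set.Ioo 0 t₁) :
    0 < bridgeVar t₁ t₂ s := by
  have hτ := le_harmonicMean h1 h12
  unfold bridgeVar
  exact div_pos (mul_pos (by linarith [hs.1]) (by linarith [hs.2])) (h1.trans_le hτ)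

theorem bridgeVar_le (h1 : 0 < t₁) (h12 : t₁ ≤ t₂) : bridgeVar t₁ t₂ s ≤ 2 * s := by
  have hτ := le_harmonicMean h1 h12
  unfold bridgeVar
  rw [div_le_iff₀ (h1.trans_le hτ)]
  nlinarith [sq_nonneg s]

theorem le_bridgeVar (h1 : 0 < t₁) (h12 : t₁ ≤ t₂) (hs : 0 ≤ s) (hs' : s ≤ t₁ / 2) :
    s ≤ bridgeVar t₁ t₂ s := by
  have hτ := le_harmonicMean h1 h12
  unfold bridgeVar
  rw [le_div_iff₀ (h1.trans_le hτ)]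
  nlinarith

end bridgeVar

theorem VN_eq_toReal_lintegralVN (f : Measure ℝ) [IsFiniteMeasure f] {t₁ t₂ N : ℝ}
    (h1 : 0 < t₁) (h12 : t₁ ≤ t₂) (hfin : lintegralVN f t₁ t₂ N ≠ ⊤) :
    VN f t₁ t₂ N = (N ^ 2)⁻¹ * (lintegralVN f t₁ t₂ N).toReal := by
  have h2 : 0 < t₂ := h1.trans_le h12
  let F : ℝ × ℝ × ℝ × ℝ → ℝ := fun p =>
    heat1 (bridgeVar t₁ t₂ p.2.2.1) (p.2.2.1 / t₂ * p.2.1 - (p.2.2.1 / t₁ * p.1 + p.2.2.2))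
  have hF : Measurable F := by
    refine measurable_heat1.comp (Measurable.prodMk ?_ (by fun_prop))
    fun_prop [bridgeVar]
  let μ := volume.restrict (Set.Icc 0 N)
  let ρ := volume.restrict (Set.Ioo 0 t₁)
  have hL : ∫⁻ p, ENNReal.ofReal (F p) ∂(μ.prod (μ.prod (ρ.prod f))) = lintegralVN f t₁ t₂ N :=
    lintegral_prod_prod_prod_reorder hF.ennreal_ofReal
  have h0 : 0 ≤ᵐ[μ.prod (μ.prod (ρ.prod f))] F := by
    have hρ : ∀ᵐ s ∂ρ, s ∈ Set.Ioo 0 t₁ := ae_restrict_mem measurableSet_Ioo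
    have := Measure.quasiMeasurePreserving_snd (μ := μ) (ν := μ.prod (ρ.prod f)) |>.ae
      (Measure.quasiMeasurePreserving_snd (μ := μ) (ν := ρ.prod f) |>.ae
        (Measure.quasiMeasurePreserving_fst (μ := ρ) (ν := f) |>.ae hρ))
    filter_upwards [this] with p hp
    exact heat1_nonneg (bridgeVar_pos h1 h12 hp).le _
  rw [← hL, ← integral_integral_integral_integral_eq_toReal_lintegral hF h0 (by rwa [hL])]
  have hVN : ∀ x₁ x₂ s y, heat1 (bridgeVar t₁ t₂ s)
      (s / (2 * t₁ * t₂ / (t₁ + t₂)) * (2 * t₁ / (t₁ + t₂) * x₂ - 2 * t₂ / (t₁ + t₂) * x₁) - y) =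
      F (x₁, x₂, s, y) := by
    intro x₁ x₂ s y
    simp only [F]
    congr 1
    field_simp
    ring
  simp only [← hVN]
  rfl

theorem setLIntegral_inv {a b : ℝ} (ha : 0 < a) (hab : a ≤ b) :
    ∫⁻ s in Set.Ioc a b, ENNReal.ofReal s⁻¹ = ENNReal.ofReal (Real.log (b / a)) := by
  have hne : (0 : ℝ) ∉ Set.uIcc a b := Set.notMem_uIcc_of_lt ha (ha.trans_le hab)
  rw [← integral_inv hne, intervalIntegral.integral_of_le hab,
    ofReal_integral_eq_lintegral_ofReal]
  · exact (intervalIntegrable_iff_integrableOn_Ioc_of_le hab).1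
      (intervalIntegral.intervalIntegrable_inv (fun x hx h => hne (h ▸ hx)) continuousOn_id)
  · filter_upwards [ae_restrict_mem measurableSet_Ioc] with s hs
    exact inv_nonneg.2 (ha.trans hs.1).le

theorem setLIntegral_rpow_neg_half {b : ℝ} (hb : 0 ≤ b) :
    ∫⁻ s in Set.Ioc 0 b, ENNReal.ofReal (s ^ (-(1 : ℝ) / 2)) = ENNReal.ofReal (2 * √b) := by
  have hint := integral_rpow (a := 0) (b := b) (r := -(1 : ℝ) / 2) (Or.inl (by norm_num))
  have hval : (b ^ (-(1 : ℝ) / 2 + 1) - 0 ^ (-(1 : ℝ) / 2 + 1)) / (-(1 : ℝ) / 2 + 1) = 2 * √b := by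
    rw [Real.sqrt_eq_rpow, Real.zero_rpow (by norm_num)]
    norm_num
    ring
  rw [← hval, ← hint, intervalIntegral.integral_of_le hb, ofReal_integral_eq_lintegral_ofReal]
  · exact (intervalIntegrable_iff_integrableOn_Ioc_of_le hb).1
      (intervalIntegral.intervalIntegrable_rpow' (by norm_num))
  · filter_upwards [ae_restrict_mem measurableSet_Ioc] with s hs
    exact Real.rpow_nonneg hs.1.le _

theorem setLIntegral_heat1_le {t₁ t₂ s N : ℝ} (h1 : 0 < t₁) (h12 : t₁ ≤ t₂)
    (hs : s ∈ Set.Ioo 0 t₁) (b : ℝ) :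
    ∫⁻ x₂ in Set.Icc 0 N, ENNReal.ofReal (heat1 (bridgeVar t₁ t₂ s) (s / t₂ * x₂ - b)) ≤
      ENNReal.ofReal (t₂ * s⁻¹) := by
  rw [setLIntegral_heat1_affine (bridgeVar_pos h1 h12 hs) (div_pos hs.1 (h1.trans_le h12)),
    inv_div, div_eq_mul_inv]
  exact mul_le_of_le_one_right' prob_le_one

theorem setLIntegral_heat1_le_rpow {t₁ t₂ s N : ℝ} (h1 : 0 < t₁) (h12 : t₁ ≤ t₂)
    (hN : 0 ≤ N) (hs : 0 < s) (hs' : s ≤ t₁ / 2) (b : ℝ) :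
    ∫⁻ x₂ in Set.Icc 0 N, ENNReal.ofReal (heat1 (bridgeVar t₁ t₂ s) (s / t₂ * x₂ - b)) ≤
      ENNReal.ofReal (N * s ^ (-(1 : ℝ) / 2)) := by
  calc _ ≤ ∫⁻ _ in Set.Icc 0 N, ENNReal.ofReal (s ^ (-(1 : ℝ) / 2)) :=
        lintegral_mono fun x => ENNReal.ofReal_le_ofReal
          (heat1_le_rpow hs (le_bridgeVar h1 h12 hs.le hs') _)
    _ = _ := by
        rw [setLIntegral_const, Real.volume_Icc, sub_zero, mul_comm, ENNReal.ofReal_mul hN]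

theorem lintegral_setLIntegral_le {f : Measure ℝ} [IsFiniteMeasure f] {N c : ℝ} (hN : 0 ≤ N)
    (g : ℝ → ℝ → ENNReal) (hg : ∀ y x, g y x ≤ ENNReal.ofReal c) :
    ∫⁻ y, (∫⁻ x in Set.Icc 0 N, g y x) ∂f ≤ ENNReal.ofReal (f.real Set.univ * N * c) := by
  calc _ ≤ ∫⁻ _, (∫⁻ _ in Set.Icc 0 N, ENNReal.ofReal c) ∂f :=
        lintegral_mono fun y => lintegral_mono fun x => hg y x
    _ = _ := by
        rw [setLIntegral_const, lintegral_const, Real.volume_Icc, sub_zero,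
          ENNReal.ofReal_mul (by positivity), ENNReal.ofReal_mul measureReal_nonneg,
          ofReal_measureReal]
        ring

theorem lintegralVN_le (f : Measure ℝ) [IsFiniteMeasure f] {t₁ t₂ N : ℝ}
    (h1 : 0 < t₁) (h12 : t₁ ≤ t₂) (hN : 0 < N) (hNt : (N ^ 2)⁻¹ ≤ t₁ / 2) :
    lintegralVN f t₁ t₂ N ≤
      ENNReal.ofReal (f.real Set.univ * N * (2 + t₂ * Real.log (t₁ * N ^ 2))) := by
  have h2 : 0 < t₂ := h1.trans_le h12
  have hb : 0 < (N ^ 2)⁻¹ := by positivity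
  have hbt : (N ^ 2)⁻¹ ≤ t₁ := by linarith
  have hlog : 0 ≤ Real.log (t₁ * N ^ 2) := by
    refine Real.log_nonneg ?_
    rwa [inv_le_iff_one_le_mul₀ (by positivity)] at hbt
  let I : ℝ → ENNReal := fun s => ∫⁻ y, (∫⁻ x₁ in Set.Icc 0 N, ∫⁻ x₂ in Set.Icc 0 N,
    ENNReal.ofReal (heat1 (bridgeVar t₁ t₂ s) (s / t₂ * x₂ - (s / t₁ * x₁ + y)))) ∂f
  have hsmall : ∫⁻ s in Set.Ioc 0 (N ^ 2)⁻¹, I s ≤ ENNReal.ofReal (f.real Set.univ * N * 2) := by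
    calc _ ≤ ∫⁻ s in Set.Ioc 0 (N ^ 2)⁻¹, ENNReal.ofReal (f.real Set.univ * N * N) *
          ENNReal.ofReal (s ^ (-(1 : ℝ) / 2)) := by
          refine setLIntegral_mono' measurableSet_Ioc fun s hs => ?_
          rw [← ENNReal.ofReal_mul (by positivity), mul_assoc (_ * N)]
          exact lintegral_setLIntegral_le hN.le _ fun y x =>
            setLIntegral_heat1_le_rpow h1 h12 hN.le hs.1 (hs.2.trans hNt) _
      _ = _ := by
          rw [lintegral_const_mul _ (by fun_prop), setLIntegral_rpow_neg_half hb.le,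
            ← ENNReal.ofReal_mul (by positivity), Real.sqrt_inv, Real.sqrt_sq hN.le]
          congr 1
          field_simp
  have hlarge : ∫⁻ s in Set.Ioo (N ^ 2)⁻¹ t₁, I s ≤
      ENNReal.ofReal (f.real Set.univ * N * (t₂ * Real.log (t₁ * N ^ 2))) := by
    calc _ ≤ ∫⁻ s in Set.Ioo (N ^ 2)⁻¹ t₁, ENNReal.ofReal (f.real Set.univ * N * t₂) *
          ENNReal.ofReal s⁻¹ := by
          refine setLIntegral_mono' measurableSet_Ioo fun s hs => ?_
          rw [← ENNReal.ofReal_mul (by positivity), mul_assoc (_ * N)]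
          exact lintegral_setLIntegral_le hN.le _ fun y x =>
            setLIntegral_heat1_le h1 h12 ⟨hb.trans hs.1, hs.2⟩ _
      _ = _ := by
          rw [lintegral_const_mul _ (by fun_prop), setLIntegral_congr Ioo_ae_eq_Ioc,
            setLIntegral_inv hb hbt, ← ENNReal.ofReal_mul (by positivity), div_inv_eq_mul,
            mul_assoc (_ * N)]
  calc lintegralVN f t₁ t₂ N
      ≤ ∫⁻ s in Set.Ioc 0 (N ^ 2)⁻¹ ∪ Set.Ioo (N ^ 2)⁻¹ t₁, I s :=
        lintegral_mono_set fun s hs => (le_or_gt s (N ^ 2)⁻¹).imp (⟨hs.1, ·⟩) (⟨·, hs.2⟩)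
    _ ≤ _ := (lintegral_union_le _ _ _).trans (add_le_add hsmall hlarge)
    _ = _ := by
        rw [← ENNReal.ofReal_add (by positivity) (by positivity), ← mul_add]

theorem le_setLIntegral_heat1 {t₁ t₂ s N M L δ x₁ y : ℝ} (h1 : 0 < t₁) (h12 : t₁ ≤ t₂)
    (hs : s ∈ Set.Ioo 0 t₁) (hN : 0 < N) (hδ : 0 < δ) (hLs : L / N ≤ s)
    (hML : 2 * M * t₂ ≤ δ * L) (hNL : 8 * t₂ ^ 2 ≤ δ ^ 3 * N * L) (hy : |y| ≤ M)
    (hx : x₁ ∈ Set.Icc (δ * N * t₁ / t₂) ((1 - δ) * N * t₁ / t₂)) :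
    ENNReal.ofReal ((1 - δ) * t₂ * s⁻¹) ≤ ∫⁻ x₂ in Set.Icc 0 N,
      ENNReal.ofReal (heat1 (bridgeVar t₁ t₂ s) (s / t₂ * x₂ - (s / t₁ * x₁ + y))) := by
  have h2 : 0 < t₂ := h1.trans_le h12
  have hs0 := hs.1
  have hvpos := bridgeVar_pos h1 h12 hs
  have hLs' : L ≤ s * N := (div_le_iff₀ hN).1 hLs
  rw [setLIntegral_heat1_affine hvpos (div_pos hs.1 h2), inv_div]
  have hmean : (s / t₁ * x₁ + y) / (s / t₂) = t₂ / t₁ * x₁ + y * t₂ / s := by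
    field_simp
  have hys : |y * t₂ / s| ≤ δ * N / 2 := by
    rw [abs_div, abs_mul, abs_of_pos h2, abs_of_pos hs0, div_le_iff₀ hs0]
    nlinarith
  have hx1 : δ * N ≤ t₂ / t₁ * x₁ := by
    have := hx.1
    rw [div_le_iff₀ h2] at this
    rw [div_mul_eq_mul_div, le_div_iff₀ h1]
    linarith
  have hx2 : t₂ / t₁ * x₁ ≤ (1 - δ) * N := by
    have := hx.2
    rw [le_div_iff₀ h2] at this
    rw [div_mul_eq_mul_div, div_le_iff₀ h1]
    linarith
  have hprob : ENNReal.ofReal (1 - δ) ≤ gaussianReal ((s / t₁ * x₁ + y) / (s / t₂))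
      (bridgeVar t₁ t₂ s / (s / t₂) ^ 2).toNNReal (Set.Icc 0 N) := by
    refine one_sub_le_gaussianReal (r := δ * N / 2) (by positivity) ?_ fun x hxm => ?_
    · rw [Real.coe_toNNReal _ (by positivity)]
      have hv : bridgeVar t₁ t₂ s / (s / t₂) ^ 2 ≤ 2 * s / (s / t₂) ^ 2 := by
        gcongr
        exact bridgeVar_le h1 h12
      refine hv.trans ?_
      have heq : 2 * s / (s / t₂) ^ 2 = 2 * t₂ ^ 2 / s := by field_simp
      rw [heq, div_le_iff₀ hs0]
      have : δ ^ 3 * N * L ≤ δ ^ 3 * N * (s * N) := by gcongr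
      nlinarith
    · rw [hmean, abs_lt] at hxm
      rw [abs_le] at hys
      constructor <;> linarith [hxm.1, hxm.2, hys.1, hys.2]
  calc ENNReal.ofReal ((1 - δ) * t₂ * s⁻¹)
      = ENNReal.ofReal (t₂ / s) * ENNReal.ofReal (1 - δ) := by
        rw [← ENNReal.ofReal_mul (by positivity)]
        congr 1
        ring
    _ ≤ _ := by gcongr

theorem le_lintegralVN (f : Measure ℝ) [IsFiniteMeasure f] {t₁ t₂ N M L δ : ℝ} (h1 : 0 < t₁)
    (h12 : t₁ ≤ t₂) (hN : 0 < N) (hL : 0 < L) (hδ : 0 < δ) (hδ2 : 2 * δ ≤ 1)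
    (hLN : L / N ≤ t₁) (hML : 2 * M * t₂ ≤ δ * L) (hNL : 8 * t₂ ^ 2 ≤ δ ^ 3 * N * L) :
    ENNReal.ofReal (f.real (Set.Icc (-M) M) * ((1 - 2 * δ) * (1 - δ) * t₁ * N) *
      Real.log (t₁ * N / L)) ≤ lintegralVN f t₁ t₂ N := by
  have h2 : 0 < t₂ := h1.trans_le h12
  have hLN0 : 0 < L / N := by positivity
  have hδ' : 0 ≤ 1 - 2 * δ := by linarith
  have hδ'' : 0 ≤ 1 - δ := by linarith
  let J := Set.Icc (δ * N * t₁ / t₂) ((1 - δ) * N * t₁ / t₂)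
  have hJN : J ⊆ Set.Icc 0 N := by
    refine Set.Icc_subset_Icc (by positivity) ?_
    rw [div_le_iff₀ h2]
    have : N * t₁ ≤ N * t₂ := by gcongr
    nlinarith [mul_pos (mul_pos hδ hN) h1]
  have hJ : volume J = ENNReal.ofReal ((1 - 2 * δ) * N * t₁ / t₂) := by
    rw [Real.volume_Icc]
    congr 1
    ring
  have hspace : ∀ s ∈ Set.Ioo (L / N) t₁,
      ENNReal.ofReal (f.real (Set.Icc (-M) M) * ((1 - 2 * δ) * (1 - δ) * t₁ * N)) *
        ENNReal.ofReal s⁻¹ ≤ ∫⁻ y, (∫⁻ x₁ in Set.Icc 0 N, ∫⁻ x₂ in Set.Icc 0 N,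
          ENNReal.ofReal (heat1 (bridgeVar t₁ t₂ s) (s / t₂ * x₂ - (s / t₁ * x₁ + y)))) ∂f := by
    intro s hs
    calc _ = ∫⁻ _ in Set.Icc (-M) M, (∫⁻ _ in J, ENNReal.ofReal ((1 - δ) * t₂ * s⁻¹)) ∂f := by
          have hs0 : 0 < s := hLN0.trans hs.1
          rw [setLIntegral_const, setLIntegral_const, hJ, ← ofReal_measureReal,
            ← ENNReal.ofReal_mul (by positivity), ← ENNReal.ofReal_mul (by positivity),
            ← ENNReal.ofReal_mul (by positivity)]
          congr 1
          field_simp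
      _ ≤ ∫⁻ y in Set.Icc (-M) M, (∫⁻ x₁ in J, ∫⁻ x₂ in Set.Icc 0 N, ENNReal.ofReal
            (heat1 (bridgeVar t₁ t₂ s) (s / t₂ * x₂ - (s / t₁ * x₁ + y)))) ∂f :=
          setLIntegral_mono' measurableSet_Icc fun y hy =>
            setLIntegral_mono' measurableSet_Icc fun x hx =>
              le_setLIntegral_heat1 h1 h12 ⟨hLN0.trans hs.1, hs.2⟩ hN hδ hs.1.le hML hNL (abs_le.2 hy) hx
      _ ≤ _ := (setLIntegral_le_lintegral _ _).trans
          (lintegral_mono fun y => lintegral_mono_set hJN)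
  calc _ = ∫⁻ s in Set.Ioo (L / N) t₁,
        ENNReal.ofReal (f.real (Set.Icc (-M) M) * ((1 - 2 * δ) * (1 - δ) * t₁ * N)) *
          ENNReal.ofReal s⁻¹ := by
        rw [lintegral_const_mul _ (by fun_prop), setLIntegral_congr Ioo_ae_eq_Ioc,
          setLIntegral_inv hLN0 hLN, ← ENNReal.ofReal_mul (by positivity), div_div_eq_mul_div]
    _ ≤ _ := setLIntegral_mono' measurableSet_Ioo hspace
    _ ≤ _ := lintegral_mono_set (Set.Ioo_subset_Ioo_left hLN0.le)

theorem tendsto_add_mul_log_div_log (a b : ℝ) :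
    Tendsto (fun N : ℝ => (a + b * Real.log N) / Real.log N) atTop (𝓝 b) := by
  have h : Tendsto (fun N : ℝ => a / Real.log N + b) atTop (𝓝 (0 + b)) :=
    (tendsto_const_nhds.div_atTop Real.tendsto_log_atTop).add_const b
  rw [zero_add] at h
  refine h.congr' ?_
  filter_upwards [eventually_gt_atTop 1] with N hN
  have := (Real.log_pos hN).ne'
  field_simp

theorem eventually_inv_sq_le {c : ℝ} (hc : 0 < c) : ∀ᶠ N : ℝ in atTop, (N ^ 2)⁻¹ ≤ c :=
  (tendsto_inv_atTop_zero.comp (tendsto_pow_atTop two_ne_zero)).eventually_le_const hc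

theorem lintegralVN_ne_top (f : Measure ℝ) [IsFiniteMeasure f] {t₁ t₂ N : ℝ}
    (h1 : 0 < t₁) (h12 : t₁ ≤ t₂) (hN : 0 < N) (hNt : (N ^ 2)⁻¹ ≤ t₁ / 2) :
    lintegralVN f t₁ t₂ N ≠ ⊤ :=
  ne_top_of_le_ne_top ENNReal.ofReal_ne_top (lintegralVN_le f h1 h12 hN hNt)

theorem isBoundedUnder_le_VN (f : Measure ℝ) [IsFiniteMeasure f] {t₁ t₂ : ℝ}
    (h1 : 0 < t₁) (h12 : t₁ ≤ t₂) :
    IsBoundedUnder (· ≤ ·) atTop fun N : ℝ => N / Real.log N * VN f t₁ t₂ N := by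
  have h2 : 0 < t₂ := h1.trans_le h12
  refine (tendsto_add_mul_log_div_log (f.real Set.univ * (2 + t₂ * Real.log t₁))
    (f.real Set.univ * (2 * t₂))).isBoundedUnder_le.mono_le ?_
  filter_upwards [eventually_gt_atTop 1, eventually_inv_sq_le (half_pos h1)] with N hN hNt
  have hN0 : 0 < N := by linarith
  have hlog := Real.log_pos hN
  have hlog' : Real.log (t₁ * N ^ 2) = Real.log t₁ + 2 * Real.log N := by
    rw [Real.log_mul h1.ne' (by positivity), Real.log_pow]
    norm_num
  have hnn : 0 ≤ Real.log (t₁ * N ^ 2) := by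
    refine Real.log_nonneg ((inv_le_iff_one_le_mul₀ (by positivity)).1 ?_)
    linarith
  have hle := ENNReal.toReal_mono ENNReal.ofReal_ne_top (lintegralVN_le f h1 h12 hN0 hNt)
  rw [ENNReal.toReal_ofReal (by positivity)] at hle
  rw [VN_eq_toReal_lintegralVN f h1 h12 (lintegralVN_ne_top f h1 h12 hN0 hNt)]
  calc _ ≤ N / Real.log N *
        ((N ^ 2)⁻¹ * (f.real Set.univ * N * (2 + t₂ * Real.log (t₁ * N ^ 2)))) := by gcongr
    _ = _ := by
        rw [hlog']
        field_simp
        ring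

theorem eventually_le_VN (f : Measure ℝ) [IsFiniteMeasure f] {t₁ t₂ M δ c : ℝ}
    (h1 : 0 < t₁) (h12 : t₁ ≤ t₂) (hM : 0 ≤ M) (hδ : 0 < δ) (hδ2 : 2 * δ ≤ 1)
    (hc : c < f.real (Set.Icc (-M) M) * ((1 - 2 * δ) * (1 - δ) * t₁)) :
    ∀ᶠ N : ℝ in atTop, c ≤ N / Real.log N * VN f t₁ t₂ N := by
  have h2 : 0 < t₂ := h1.trans_le h12
  obtain ⟨L, hL, hML⟩ : ∃ L : ℝ, 0 < L ∧ 2 * M * t₂ ≤ δ * L := by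
    refine ⟨2 * M * t₂ / δ + 1, by positivity, ?_⟩
    rw [mul_add, mul_div_cancel₀ _ hδ.ne']
    linarith
  set K := f.real (Set.Icc (-M) M) * ((1 - 2 * δ) * (1 - δ) * t₁) with hK
  have hlim := tendsto_add_mul_log_div_log (K * (Real.log t₁ - Real.log L)) K
  filter_upwards [eventually_gt_atTop 1, eventually_inv_sq_le (half_pos h1),
    hlim.eventually_const_le hc, eventually_ge_atTop (L / t₁),
    eventually_ge_atTop (8 * t₂ ^ 2 / (δ ^ 3 * L))] with N hN hNt hcN hLN hNL
  have hN0 : 0 < N := by linarith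
  have hlog := Real.log_pos hN
  rw [div_le_iff₀ h1] at hLN
  rw [div_le_iff₀ (by positivity)] at hNL
  have hlog' : Real.log (t₁ * N / L) = Real.log t₁ + Real.log N - Real.log L := by
    rw [Real.log_div (by positivity) hL.ne', Real.log_mul h1.ne' hN0.ne']
  have hfin := lintegralVN_ne_top f h1 h12 hN0 hNt
  have hle := (ENNReal.ofReal_le_iff_le_toReal hfin).1 (le_lintegralVN f h1 h12 hN0 hL hδ hδ2
    ((div_le_iff₀ hN0).2 (by linarith)) hML (by linarith))
  rw [VN_eq_toReal_lintegralVN f h1 h12 hfin]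
  calc c ≤ _ := hcN
    _ = N / Real.log N * ((N ^ 2)⁻¹ * (f.real (Set.Icc (-M) M) *
          ((1 - 2 * δ) * (1 - δ) * t₁ * N) * Real.log (t₁ * N / L))) := by
        rw [hlog', hK]
        field_simp
        ring
    _ ≤ _ := by gcongr

theorem tendsto_measureReal_Icc_neg_nat (f : Measure ℝ) [IsFiniteMeasure f] :
    Tendsto (fun n : ℕ => f.real (Set.Icc (-(n : ℝ)) n)) atTop (𝓝 (f.real Set.univ)) := by
  have hmono : Monotone fun n : ℕ => Set.Icc (-(n : ℝ)) n := fun m n hmn =>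
    Set.Icc_subset_Icc (neg_le_neg (Nat.cast_le.2 hmn)) (Nat.cast_le.2 hmn)
  have hunion : ⋃ n : ℕ, Set.Icc (-(n : ℝ)) n = Set.univ := by
    refine Set.eq_univ_of_forall fun x => Set.mem_iUnion.2 ?_
    obtain ⟨n, hn⟩ := exists_nat_ge |x|
    exact ⟨n, abs_le.1 hn⟩
  have h := tendsto_measure_iUnion_atTop (μ := f) hmono
  rw [hunion] at h
  exact (ENNReal.tendsto_toReal (measure_ne_top f _)).comp h

/-- For a finite nonnegative Borel measure `f` on `ℝ` and `0 < t₁ ≤ t₂`,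
`liminf_{N→∞} (N / log N) V_N ≥ t₁ f(ℝ)`. -/
theorem stmt_9 (f : Measure ℝ) [IsFiniteMeasure f] (t₁ t₂ : ℝ)
    (h1 : 0 < t₁) (h12 : t₁ ≤ t₂) :
    t₁ * (f Set.univ).toReal ≤
      Filter.liminf (fun N : ℝ => (N / Real.log N) * VN f t₁ t₂ N) Filter.atTop := by
  refine le_of_forall_lt_imp_le_of_dense fun c hc => ?_
  refine le_liminf_of_le (isBoundedUnder_le_VN f h1 h12).isCoboundedUnder_ge ?_
  have hδ : Tendsto (fun n : ℕ => 1 / ((n : ℝ) + 1)) atTop (𝓝 0) :=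
    tendsto_one_div_add_atTop_nhds_zero_nat
  have hlim : Tendsto (fun n : ℕ => f.real (Set.Icc (-(n : ℝ)) n) *
      ((1 - 2 * (1 / ((n : ℝ) + 1))) * (1 - 1 / ((n : ℝ) + 1)) * t₁)) atTop
      (𝓝 (f.real Set.univ * ((1 - 2 * 0) * (1 - 0) * t₁))) :=
    (tendsto_measureReal_Icc_neg_nat f).mul
      ((((hδ.const_mul 2).const_sub 1).mul (hδ.const_sub 1)).mul_const t₁)
  have hc' : c < f.real Set.univ * ((1 - 2 * 0) * (1 - 0) * t₁) := by
    rw [mul_comm] at hc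
    simpa [Measure.real] using hc
  obtain ⟨n, hn, hn1⟩ := ((hlim.eventually_const_lt hc').and (eventually_ge_atTop 1)).exists
  have hn1' : (1 : ℝ) ≤ n := Nat.one_le_cast.2 hn1
  refine eventually_le_VN f h1 h12 n.cast_nonneg (by positivity) ?_ hn
  rw [mul_one_div, div_le_one (by positivity)]
  linarith
end

section
/- Let d ≥ 1, β ∈ (0,1), and 0 < t₁ ≤ t₂. Define V_N := N^{−2d} ∫_{[0,N]^{2d}} ∫_0^{t₁} ∫_{ℝ^d} p_{2s(τ−s)/τ}((s/τ)(τ₂x₂ − τ₁x₁) − y) ‖y‖^{−β} dy ds dx₁ dx₂. Then lim_{N→∞} N^{β} · V_N = (t₁^{1−β} τ^{β}/(1−β)) · ∫_{ℝ^d} (I_{τ₂} ⋆ Ĩ_{τ₁})(z) ‖z‖^{−β} dz. -/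
open MeasureTheory
open scoped Classical

/-- d-dimensional heat kernel `p_t(x) = (2πt)^{-d/2} exp(-‖x‖²/(2t))`. -/
noncomputable def heatKernel (d : ℕ) (t : ℝ) (x : EuclideanSpace ℝ (Fin d)) : ℝ :=
  (2 * Real.pi * t) ^ (-(d : ℝ) / 2) * Real.exp (-‖x‖ ^ 2 / (2 * t))

/-- `I_m(x) = m^{-d} 1_{[0,m]^d}(x)`. -/
noncomputable def Ibox (d : ℕ) (m : ℝ) (x : EuclideanSpace ℝ (Fin d)) : ℝ :=
  if ∀ j, x j ∈ Set.Icc (0 : ℝ) m then (m ^ d)⁻¹ else 0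

/-- `Ĩ_m(x) = I_m(-x)`. -/
noncomputable def IboxTilde (d : ℕ) (m : ℝ) (x : EuclideanSpace ℝ (Fin d)) : ℝ :=
  Ibox d m (-x)

/-- Convolution on `ℝ^d` with respect to Lebesgue measure. -/
noncomputable def convE (d : ℕ) (g h : EuclideanSpace ℝ (Fin d) → ℝ)
    (x : EuclideanSpace ℝ (Fin d)) : ℝ :=
  ∫ y, g (x - y) * h y

/-- `V_N = N^{-2d} ∫_{[0,N]^{2d}} ∫_0^{t₁} ∫_{ℝ^d} p_{2s(τ-s)/τ}((s/τ)(τ₂x₂-τ₁x₁) - y)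
‖y‖^{-β} dy ds dx₁ dx₂`. -/
noncomputable def VNriesz (d : ℕ) (β t₁ t₂ N : ℝ) : ℝ :=
  let τ := 2 * t₁ * t₂ / (t₁ + t₂)
  let τ₁ := 2 * t₂ / (t₁ + t₂)
  let τ₂ := 2 * t₁ / (t₁ + t₂)
  (N ^ (2 * d))⁻¹ *
    ∫ x₁ in {x : EuclideanSpace ℝ (Fin d) | ∀ j, x j ∈ Set.Icc (0 : ℝ) N},
    ∫ x₂ in {x : EuclideanSpace ℝ (Fin d) | ∀ j, x j ∈ Set.Icc (0 : ℝ) N},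
    ∫ s in Set.Ioo (0 : ℝ) t₁,
    ∫ y : EuclideanSpace ℝ (Fin d),
      heatKernel d (2 * s * (τ - s) / τ) ((s / τ) • (τ₂ • x₂ - τ₁ • x₁) - y) * ‖y‖ ^ (-β)

lemma integrableOn_ball_norm_rpow_neg {d : ℕ} (hd : 1 ≤ d) {β : ℝ} (hβ : β < 1) (r : ℝ) :
    IntegrableOn (fun y : EuclideanSpace ℝ (Fin d) => ‖y‖ ^ (-β)) (Metric.ball 0 r) := by
  have : Nonempty (Fin d) := ⟨⟨0, hd⟩⟩
  rw [integrableOn_fun_norm_addHaar volume (f := fun s : ℝ => s ^ (-β))]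
  have h : IntegrableOn (fun s : ℝ => s ^ ((d : ℝ) - 1 - β)) (Set.Ioo 0 r) := by
    rcases le_or_gt r 0 with hr | hr
    · simp [Set.Ioo_eq_empty_of_le hr]
    · have hd' : (1 : ℝ) ≤ d := by exact_mod_cast hd
      rw [← intervalIntegrable_iff_integrableOn_Ioo_of_le hr.le]
      exact intervalIntegral.intervalIntegrable_rpow' (by linarith)
  refine h.congr_fun (fun s hs => ?_) measurableSet_Ioo
  simp only [finrank_euclideanSpace, Fintype.card_fin, smul_eq_mul]
  rw [← Real.rpow_natCast, ← Real.rpow_add hs.1, Nat.cast_sub hd]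
  congr 1
  push_cast
  ring

lemma setIntegral_ball_norm_rpow_neg (d : ℕ) (β : ℝ) {r : ℝ} (hr : 0 < r) :
    ∫ y in Metric.ball (0 : EuclideanSpace ℝ (Fin d)) r, ‖y‖ ^ (-β) =
      r ^ ((d : ℝ) - β) *
        ∫ y in Metric.ball (0 : EuclideanSpace ℝ (Fin d)) 1, ‖y‖ ^ (-β) := by
  have h := Measure.setIntegral_comp_smul_of_pos volume
    (fun y : EuclideanSpace ℝ (Fin d) => ‖y‖ ^ (-β)) (Metric.ball 0 1) hr
  simp only [norm_smul, Real.norm_of_nonneg hr.le, Real.mul_rpow hr.le (norm_nonneg _),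
    smul_unitBall_of_pos hr, integral_const_mul, finrank_euclideanSpace, Fintype.card_fin,
    smul_eq_mul] at h
  rw [eq_inv_mul_iff_mul_eq₀ (by positivity), ← mul_assoc, ← Real.rpow_natCast,
    ← Real.rpow_add hr] at h
  rw [← h, sub_eq_add_neg]

lemma heatKernel_nonneg (d : ℕ) {t : ℝ} (ht : 0 ≤ t) (x : EuclideanSpace ℝ (Fin d)) :
    0 ≤ heatKernel d t x := by
  unfold heatKernel
  positivity

lemma measurable_heatKernel (d : ℕ) :
    Measurable fun p : ℝ × EuclideanSpace ℝ (Fin d) => heatKernel d p.1 p.2 := by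
  unfold heatKernel
  fun_prop

lemma integral_heatKernel (d : ℕ) {t : ℝ} (ht : 0 < t) :
    ∫ x : EuclideanSpace ℝ (Fin d), heatKernel d t x = 1 := by
  have h := GaussianFourier.integral_rexp_neg_mul_sq_norm
    (V := EuclideanSpace ℝ (Fin d)) (b := (2 * t)⁻¹) (by positivity)
  unfold heatKernel
  rw [integral_const_mul]
  have h2 : ∀ x : EuclideanSpace ℝ (Fin d), -‖x‖ ^ 2 / (2 * t) = -(2 * t)⁻¹ * ‖x‖ ^ 2 := by
    intro x
    ring
  simp only [h2, h, finrank_euclideanSpace, Fintype.card_fin, div_inv_eq_mul]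
  rw [show Real.pi * (2 * t) = 2 * Real.pi * t by ring, ← Real.rpow_add (by positivity),
    ← add_div, neg_add_cancel, zero_div, Real.rpow_zero]

lemma integrable_heatKernel (d : ℕ) {t : ℝ} (ht : 0 < t) :
    Integrable (heatKernel d t) :=
  not_imp_comm.1 integral_undef (by simp [integral_heatKernel d ht])

lemma rpow_mul_exp_neg_le (d : ℕ) (hd : 1 ≤ d) {u : ℝ} (hu : 0 ≤ u) :
    u ^ ((d : ℝ) / 2) * Real.exp (-u / 8) ≤ (4 * d : ℝ) ^ ((d : ℝ) / 2) := by
  have hd' : (0 : ℝ) < d := by exact_mod_cast hd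
  have h1 : u / (4 * d) ≤ Real.exp (u / (4 * d)) := by
    linarith [Real.add_one_le_exp (u / (4 * d))]
  have h2 := Real.rpow_le_rpow (by positivity) h1 (by positivity : (0 : ℝ) ≤ (d : ℝ) / 2)
  rw [← Real.exp_mul, Real.div_rpow hu (by positivity), div_le_iff₀ (by positivity),
    show u / (4 * d) * ((d : ℝ) / 2) = u / 8 by field_simp; ring] at h2
  rw [neg_div, Real.exp_neg, ← div_eq_mul_inv, div_le_iff₀ (Real.exp_pos _)]
  linarith

lemma integrableOn_near {d : ℕ} (hd : 1 ≤ d) {β : ℝ} (hβ : β < 1) {t : ℝ} (ht : 0 < t)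
    (x : EuclideanSpace ℝ (Fin d)) (r : ℝ) :
    IntegrableOn (fun y => heatKernel d t (x - y) * ‖y‖ ^ (-β)) (Metric.ball 0 r) := by
  refine (integrableOn_ball_norm_rpow_neg hd hβ r).bdd_mul
    (c := (2 * Real.pi * t) ^ (-(d : ℝ) / 2)) ?_ (ae_of_all _ fun y => ?_)
  · exact ((measurable_heatKernel d).comp
      (measurable_const.prodMk (measurable_const.sub measurable_id))).aestronglyMeasurable
  · rw [Real.norm_of_nonneg (heatKernel_nonneg d ht.le _)]
    unfold heatKernel
    refine mul_le_of_le_one_right (by positivity) (Real.exp_le_one_iff.2 ?_)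
    rw [neg_div]
    exact neg_nonpos.2 (by positivity)

lemma exists_setIntegral_near_le {d : ℕ} (hd : 1 ≤ d) {β : ℝ} (hβ : β < 1) :
    ∃ K : ℝ, 0 ≤ K ∧ ∀ t : ℝ, 0 < t → ∀ x : EuclideanSpace ℝ (Fin d), x ≠ 0 →
      ∫ y in Metric.ball 0 (‖x‖ / 2), heatKernel d t (x - y) * ‖y‖ ^ (-β) ≤
        K * ‖x‖ ^ (-β) *
          ((‖x‖ ^ 2 / t) ^ ((d : ℝ) / 2) * Real.exp (-(‖x‖ ^ 2 / t) / 8)) := by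
  have hK : 0 ≤ ∫ y in Metric.ball (0 : EuclideanSpace ℝ (Fin d)) 1, ‖y‖ ^ (-β) :=
    integral_nonneg fun _ => by positivity
  refine ⟨(2 * Real.pi) ^ (-(d : ℝ) / 2) * (1 / 2 : ℝ) ^ ((d : ℝ) - β) *
    ∫ y in Metric.ball (0 : EuclideanSpace ℝ (Fin d)) 1, ‖y‖ ^ (-β), by positivity,
    fun t ht x hx => ?_⟩
  have hx' : 0 < ‖x‖ := norm_pos_iff.2 hx
  have hle : ∫ y in Metric.ball 0 (‖x‖ / 2), heatKernel d t (x - y) * ‖y‖ ^ (-β) ≤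
      ∫ y in Metric.ball (0 : EuclideanSpace ℝ (Fin d)) (‖x‖ / 2),
        ((2 * Real.pi * t) ^ (-(d : ℝ) / 2) * Real.exp (-(‖x‖ ^ 2 / t) / 8)) *
          ‖y‖ ^ (-β) := by
    refine setIntegral_mono_on (integrableOn_near hd hβ ht x _)
      ((integrableOn_ball_norm_rpow_neg hd hβ _).const_mul _) measurableSet_ball fun y hy => ?_
    refine mul_le_mul_of_nonneg_right ?_ (by positivity)
    unfold heatKernel
    refine mul_le_mul_of_nonneg_left (Real.exp_le_exp.2 ?_) (by positivity)
    have hy' : ‖y‖ < ‖x‖ / 2 := by simpa using hy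
    have h1 : ‖x‖ / 2 ≤ ‖x - y‖ := by linarith [norm_sub_norm_le x y]
    have h2 : (‖x‖ / 2) ^ 2 ≤ ‖x - y‖ ^ 2 := pow_le_pow_left₀ (by positivity) h1 2
    rw [div_le_iff₀ (by positivity),
      show -(‖x‖ ^ 2 / t) / 8 * (2 * t) = -(‖x‖ / 2) ^ 2 by field_simp; norm_num]
    linarith
  refine hle.trans_eq ?_
  rw [integral_const_mul, setIntegral_ball_norm_rpow_neg d β (by positivity),
    Real.mul_rpow (by positivity) ht.le, Real.div_rpow (by positivity) ht.le,
    ← Real.rpow_natCast, ← Real.rpow_mul hx'.le, neg_div, Real.rpow_neg ht.le,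
    div_eq_mul_one_div ‖x‖ 2, Real.mul_rpow hx'.le (by norm_num), sub_eq_add_neg (d : ℝ) β,
    Real.rpow_add hx', show ((2 : ℕ) : ℝ) * ((d : ℝ) / 2) = d by push_cast; ring]
  ring

lemma integrableOn_far {d : ℕ} {β : ℝ} (hβ : 0 < β) {t : ℝ} (ht : 0 < t)
    (x : EuclideanSpace ℝ (Fin d)) {r : ℝ} (hr : 0 < r) :
    IntegrableOn (fun y => heatKernel d t (x - y) * ‖y‖ ^ (-β)) (Metric.ball 0 r)ᶜ := by
  refine ((integrable_heatKernel d ht).comp_sub_left x).integrableOn.mul_bdd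
    (c := r ^ (-β)) (Measurable.aestronglyMeasurable (by fun_prop)) ?_
  refine (ae_restrict_iff' measurableSet_ball.compl).2 (ae_of_all _ fun y hy => ?_)
  have hy' : r ≤ ‖y‖ := by simpa using hy
  rw [Real.norm_of_nonneg (by positivity)]
  exact Real.rpow_le_rpow_of_nonpos hr hy' (by linarith)

lemma setIntegral_far_le {d : ℕ} {β : ℝ} (hβ : 0 < β) {t : ℝ} (ht : 0 < t)
    (x : EuclideanSpace ℝ (Fin d)) {r : ℝ} (hr : 0 < r) :
    ∫ y in (Metric.ball 0 r)ᶜ, heatKernel d t (x - y) * ‖y‖ ^ (-β) ≤ r ^ (-β) := by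
  have hI := (integrable_heatKernel d ht).comp_sub_left x
  calc _ ≤ ∫ y in (Metric.ball 0 r)ᶜ, heatKernel d t (x - y) * r ^ (-β) := by
        refine setIntegral_mono_on (integrableOn_far hβ ht x hr)
          (hI.mul_const _).integrableOn measurableSet_ball.compl fun y hy => ?_
        have hy' : r ≤ ‖y‖ := by simpa using hy
        exact mul_le_mul_of_nonneg_left (Real.rpow_le_rpow_of_nonpos hr hy' (by linarith))
          (heatKernel_nonneg d ht.le _)
    _ ≤ ∫ y, heatKernel d t (x - y) * r ^ (-β) :=
        setIntegral_le_integral (hI.mul_const _) (ae_of_all _ fun y =>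
          mul_nonneg (heatKernel_nonneg d ht.le _) (by positivity))
    _ = r ^ (-β) := by
        rw [integral_mul_const, integral_sub_left_eq_self (heatKernel d t) volume x,
          integral_heatKernel d ht, one_mul]

/-- The heat semigroup applied to the Riesz kernel `‖·‖ ^ (-β)`. -/
noncomputable def heatRiesz (d : ℕ) (β t : ℝ) (x : EuclideanSpace ℝ (Fin d)) : ℝ :=
  ∫ y, heatKernel d t (x - y) * ‖y‖ ^ (-β)

lemma heatRiesz_nonneg (d : ℕ) (β : ℝ) {t : ℝ} (ht : 0 ≤ t) (x : EuclideanSpace ℝ (Fin d)) :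
    0 ≤ heatRiesz d β t x :=
  integral_nonneg fun _ => mul_nonneg (heatKernel_nonneg d ht _) (by positivity)

lemma measurable_heatRiesz (d : ℕ) (β : ℝ) :
    Measurable fun p : ℝ × EuclideanSpace ℝ (Fin d) => heatRiesz d β p.1 p.2 := by
  have h : Measurable fun q : (ℝ × EuclideanSpace ℝ (Fin d)) × EuclideanSpace ℝ (Fin d) =>
      heatKernel d q.1.1 (q.1.2 - q.2) * ‖q.2‖ ^ (-β) :=
    ((measurable_heatKernel d).comp
      (g := fun p : ℝ × EuclideanSpace ℝ (Fin d) => heatKernel d p.1 p.2)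
      (f := fun q : (ℝ × EuclideanSpace ℝ (Fin d)) × EuclideanSpace ℝ (Fin d) =>
        (q.1.1, q.1.2 - q.2)) (by fun_prop)).mul (by fun_prop)
  exact h.stronglyMeasurable.integral_prod_right'.measurable

lemma heatRiesz_eq_near_add_far {d : ℕ} (hd : 1 ≤ d) {β : ℝ} (hβ : β ∈ Set.Ioo (0 : ℝ) 1)
    {t : ℝ} (ht : 0 < t) (x : EuclideanSpace ℝ (Fin d)) {r : ℝ} (hr : 0 < r) :
    heatRiesz d β t x =
      (∫ y in Metric.ball 0 r, heatKernel d t (x - y) * ‖y‖ ^ (-β)) +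
        ∫ y in (Metric.ball 0 r)ᶜ, heatKernel d t (x - y) * ‖y‖ ^ (-β) := by
  refine (integral_add_compl measurableSet_ball ?_).symm
  rw [← integrableOn_univ, ← Set.union_compl_self (Metric.ball 0 r)]
  exact (integrableOn_near hd hβ.2 ht x r).union (integrableOn_far hβ.1 ht x hr)

lemma exists_heatRiesz_le {d : ℕ} (hd : 1 ≤ d) {β : ℝ} (hβ : β ∈ Set.Ioo (0 : ℝ) 1) :
    ∃ C : ℝ, 0 ≤ C ∧ ∀ t : ℝ, 0 < t → ∀ x : EuclideanSpace ℝ (Fin d), x ≠ 0 →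
      heatRiesz d β t x ≤ C * ‖x‖ ^ (-β) := by
  obtain ⟨K, hK, hnear⟩ := exists_setIntegral_near_le hd hβ.2
  refine ⟨K * (4 * d : ℝ) ^ ((d : ℝ) / 2) + (1 / 2 : ℝ) ^ (-β), by positivity,
    fun t ht x hx => ?_⟩
  have hx' : 0 < ‖x‖ := norm_pos_iff.2 hx
  rw [heatRiesz_eq_near_add_far hd hβ ht x (half_pos hx'), add_mul]
  refine add_le_add ((hnear t ht x hx).trans ?_)
    ((setIntegral_far_le hβ.1 ht x (half_pos hx')).trans_eq ?_)
  · rw [mul_right_comm _ ((4 * d : ℝ) ^ ((d : ℝ) / 2))]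
    exact mul_le_mul_of_nonneg_left (rpow_mul_exp_neg_le d hd (by positivity)) (by positivity)
  · rw [div_eq_mul_one_div, Real.mul_rpow hx'.le (by norm_num), mul_comm]

lemma tendsto_near {d : ℕ} (hd : 1 ≤ d) {β : ℝ} (hβ : β < 1) {t : ℝ} (ht : 0 < t)
    {x : EuclideanSpace ℝ (Fin d)} (hx : x ≠ 0) :
    Filter.Tendsto (fun N : ℝ => N ^ β * ∫ y in Metric.ball 0 (‖N • x‖ / 2),
      heatKernel d t (N • x - y) * ‖y‖ ^ (-β)) Filter.atTop (nhds 0) := by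
  have hx' : 0 < ‖x‖ := norm_pos_iff.2 hx
  obtain ⟨K, -, hnear⟩ := exists_setIntegral_near_le hd hβ
  have hu : Filter.Tendsto (fun N : ℝ => N ^ 2 * (‖x‖ ^ 2 / t)) Filter.atTop Filter.atTop :=
    (Filter.tendsto_pow_atTop two_ne_zero).atTop_mul_const (by positivity)
  have hlim := ((tendsto_rpow_mul_exp_neg_mul_atTop_nhds_zero ((d : ℝ) / 2) (1 / 8)
    (by norm_num)).comp hu).const_mul (K * ‖x‖ ^ (-β))
  rw [mul_zero] at hlim
  refine tendsto_of_tendsto_of_tendsto_of_le_of_le' tendsto_const_nhds hlim ?_ ?_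
  · filter_upwards [Filter.eventually_gt_atTop 0] with N hN
    exact mul_nonneg (by positivity) (integral_nonneg fun _ =>
      mul_nonneg (heatKernel_nonneg d ht.le _) (by positivity))
  · filter_upwards [Filter.eventually_gt_atTop 0] with N hN
    refine (mul_le_mul_of_nonneg_left (hnear t ht (N • x)
      (smul_ne_zero hN.ne' hx)) (by positivity)).trans_eq ?_
    have h1 : N ^ β * N ^ (-β) = 1 := by rw [← Real.rpow_add hN, add_neg_cancel, Real.rpow_zero]
    rw [norm_smul, Real.norm_of_nonneg hN.le, Real.mul_rpow hN.le hx'.le,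
      Function.comp_apply, mul_pow, mul_div_assoc,
      show -(1 / 8) * (N ^ 2 * (‖x‖ ^ 2 / t)) = -(N ^ 2 * (‖x‖ ^ 2 / t)) / 8 by ring]
    linear_combination (K * ‖x‖ ^ (-β) * ((N ^ 2 * (‖x‖ ^ 2 / t)) ^ ((d : ℝ) / 2) *
      Real.exp (-(N ^ 2 * (‖x‖ ^ 2 / t)) / 8))) * h1

lemma tendsto_far {d : ℕ} {β : ℝ} (hβ : 0 < β) {t : ℝ} (ht : 0 < t)
    {x : EuclideanSpace ℝ (Fin d)} (hx : x ≠ 0) :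
    Filter.Tendsto (fun N : ℝ => N ^ β * ∫ y in (Metric.ball 0 (‖N • x‖ / 2))ᶜ,
      heatKernel d t (N • x - y) * ‖y‖ ^ (-β)) Filter.atTop (nhds (‖x‖ ^ (-β))) := by
  have hx' : 0 < ‖x‖ := norm_pos_iff.2 hx
  let f : EuclideanSpace ℝ (Fin d) → ℝ :=
    (Metric.ball 0 (‖x‖ / 2))ᶜ.indicator fun y => ‖y‖ ^ (-β)
  have hf : Measurable f := Measurable.indicator (by fun_prop) measurableSet_ball.compl
  have hfb : ∀ y, ‖f y‖ ≤ (‖x‖ / 2) ^ (-β) := by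
    intro y
    by_cases hy : y ∈ (Metric.ball (0 : EuclideanSpace ℝ (Fin d)) (‖x‖ / 2))ᶜ
    · have hy' : ‖x‖ / 2 ≤ ‖y‖ := by simpa using hy
      simp only [f, Set.indicator_of_mem hy]
      rw [Real.norm_of_nonneg (by positivity)]
      exact Real.rpow_le_rpow_of_nonpos (by positivity) hy' (by linarith)
    · simp only [f, Set.indicator_of_notMem hy, norm_zero]
      positivity
  have hfx : Filter.Tendsto f (nhds x) (nhds (‖x‖ ^ (-β))) := by
    have hc : Filter.Tendsto (fun y : EuclideanSpace ℝ (Fin d) => ‖y‖ ^ (-β)) (nhds x)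
        (nhds (‖x‖ ^ (-β))) :=
      (continuous_norm.tendsto x).rpow_const (Or.inl hx'.ne')
    refine hc.congr' ?_
    have hev : ∀ᶠ y in nhds x, ‖x‖ / 2 < ‖y‖ :=
      (continuous_norm.tendsto x).eventually_const_lt (by linarith)
    filter_upwards [hev] with y hy
    have hy' : y ∈ (Metric.ball (0 : EuclideanSpace ℝ (Fin d)) (‖x‖ / 2))ᶜ := by
      simpa using hy.le
    exact (Set.indicator_of_mem hy' fun y => ‖y‖ ^ (-β)).symm
  have hmain : Filter.Tendsto (fun N : ℝ => ∫ w, heatKernel d t w * f (x - N⁻¹ • w))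
      Filter.atTop (nhds (∫ w, heatKernel d t w * ‖x‖ ^ (-β))) := by
    refine tendsto_integral_filter_of_dominated_convergence
      (fun w => heatKernel d t w * (‖x‖ / 2) ^ (-β)) ?_ ?_
      ((integrable_heatKernel d ht).mul_const _) ?_
    · refine Filter.Eventually.of_forall fun N => ?_
      exact (integrable_heatKernel d ht).aestronglyMeasurable.mul
        (hf.comp (by fun_prop)).aestronglyMeasurable
    · refine Filter.Eventually.of_forall fun N => ae_of_all _ fun w => ?_
      rw [norm_mul, Real.norm_of_nonneg (heatKernel_nonneg d ht.le _)]
      exact mul_le_mul_of_nonneg_left (hfb _) (heatKernel_nonneg d ht.le _)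
    · refine ae_of_all _ fun w => (hfx.comp ?_).const_mul _
      have := (tendsto_inv_atTop_zero (𝕜 := ℝ)).smul_const w
      simpa using this.const_sub x
  rw [integral_mul_const, integral_heatKernel d ht, one_mul] at hmain
  refine hmain.congr' ?_
  filter_upwards [Filter.eventually_gt_atTop 0] with N hN
  rw [← integral_indicator measurableSet_ball.compl, ← integral_const_mul,
    ← integral_sub_left_eq_self _ volume (N • x)]
  refine integral_congr_ae (ae_of_all _ fun y => ?_)
  have hyx : x - N⁻¹ • (N • x - y) = N⁻¹ • y := by
    rw [smul_sub, smul_smul, inv_mul_cancel₀ hN.ne', one_smul, sub_sub_cancel]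
  have hmem : N⁻¹ • y ∈ (Metric.ball (0 : EuclideanSpace ℝ (Fin d)) (‖x‖ / 2))ᶜ ↔
      y ∈ (Metric.ball (0 : EuclideanSpace ℝ (Fin d)) (‖N • x‖ / 2))ᶜ := by
    simp only [Set.mem_compl_iff, Metric.mem_ball, dist_zero_right, not_lt, norm_smul, norm_inv,
      Real.norm_of_nonneg hN.le]
    rw [le_inv_mul_iff₀ hN, mul_div_assoc]
  simp only [hyx]
  by_cases h : y ∈ (Metric.ball (0 : EuclideanSpace ℝ (Fin d)) (‖N • x‖ / 2))ᶜ
  · simp only [f, Set.indicator_of_mem (hmem.2 h)]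
    rw [Set.indicator_of_mem h, norm_smul, norm_inv, Real.norm_of_nonneg hN.le,
      Real.mul_rpow (by positivity) (norm_nonneg _), Real.inv_rpow hN.le, Real.rpow_neg hN.le,
      inv_inv]
    ring
  · simp only [f, Set.indicator_of_notMem h, Set.indicator_of_notMem (mt hmem.1 h), mul_zero]

lemma tendsto_rpow_mul_heatRiesz_smul {d : ℕ} (hd : 1 ≤ d) {β : ℝ}
    (hβ : β ∈ Set.Ioo (0 : ℝ) 1) {t : ℝ} (ht : 0 < t) {x : EuclideanSpace ℝ (Fin d)}
    (hx : x ≠ 0) :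
    Filter.Tendsto (fun N : ℝ => N ^ β * heatRiesz d β t (N • x)) Filter.atTop
      (nhds (‖x‖ ^ (-β))) := by
  have h := (tendsto_near hd hβ.2 ht hx).add (tendsto_far hβ.1 ht hx)
  rw [zero_add] at h
  refine h.congr' ?_
  filter_upwards [Filter.eventually_gt_atTop 0] with N hN
  rw [heatRiesz_eq_near_add_far hd hβ ht (N • x)
    (half_pos (norm_pos_iff.2 (smul_ne_zero hN.ne' hx))), mul_add]

/-- The cube `[0, m]^d`. -/
def cube (d : ℕ) (m : ℝ) : Set (EuclideanSpace ℝ (Fin d)) :=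
  {x | ∀ j, x j ∈ Set.Icc (0 : ℝ) m}

lemma measurableSet_cube (d : ℕ) (m : ℝ) : MeasurableSet (cube d m) := by
  have h : cube d m = ⋂ j, (fun x : EuclideanSpace ℝ (Fin d) => x j) ⁻¹' Set.Icc 0 m := by
    ext x
    simp [cube]
  rw [h]
  exact MeasurableSet.iInter fun j => measurableSet_Icc.preimage (by fun_prop)

lemma volume_cube_lt_top (d : ℕ) (m : ℝ) : volume (cube d m) < ⊤ := by
  have h : cube d m = WithLp.ofLp ⁻¹' Set.Icc (0 : Fin d → ℝ) (fun _ => m) := by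
    ext x
    simp [cube, Pi.le_def, forall_and]
  rw [h, (PiLp.volume_preserving_ofLp (Fin d)).measure_preimage
    measurableSet_Icc.nullMeasurableSet]
  exact isCompact_Icc.measure_lt_top

open scoped Pointwise in
lemma smul_cube_one (d : ℕ) {m : ℝ} (hm : 0 < m) : m • cube d 1 = cube d m := by
  ext x
  simp only [Set.mem_smul_set_iff_inv_smul_mem₀ hm.ne', cube, Set.mem_ofPred_eq, PiLp.smul_apply,
    smul_eq_mul, Set.mem_Icc]
  refine forall_congr' fun j => and_congr ?_ ?_
  · exact mul_nonneg_iff_of_pos_left (inv_pos.2 hm)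
  · rw [inv_mul_le_iff₀ hm, mul_one]

lemma setIntegral_cube_eq (d : ℕ) {m : ℝ} (hm : 0 < m) (f : EuclideanSpace ℝ (Fin d) → ℝ) :
    ∫ x in cube d m, f x = m ^ d * ∫ u in cube d 1, f (m • u) := by
  rw [Measure.setIntegral_comp_smul_of_pos volume f _ hm, smul_cube_one d hm,
    finrank_euclideanSpace, Fintype.card_fin, smul_eq_mul, mul_inv_cancel_left₀ (by positivity)]

lemma Ibox_eq_indicator (d : ℕ) (m : ℝ) :
    Ibox d m = (cube d m).indicator fun _ => (m ^ d)⁻¹ := by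
  ext x
  exact if_congr Iff.rfl rfl rfl

lemma integrable_Ibox (d : ℕ) (m : ℝ) : Integrable (Ibox d m) := by
  rw [Ibox_eq_indicator, integrable_indicator_iff (measurableSet_cube d m)]
  exact integrableOn_const (volume_cube_lt_top d m).ne

lemma Ibox_nonneg (d : ℕ) {m : ℝ} (hm : 0 ≤ m) (x : EuclideanSpace ℝ (Fin d)) :
    0 ≤ Ibox d m x := by
  unfold Ibox
  split_ifs <;> positivity

lemma Ibox_le (d : ℕ) {m : ℝ} (hm : 0 ≤ m) (x : EuclideanSpace ℝ (Fin d)) :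
    Ibox d m x ≤ (m ^ d)⁻¹ := by
  unfold Ibox
  split_ifs
  · exact le_rfl
  · positivity

lemma integral_Ibox_mul (d : ℕ) {m : ℝ} (hm : 0 < m) (g : EuclideanSpace ℝ (Fin d) → ℝ) :
    ∫ v, Ibox d m v * g v = ∫ u in cube d 1, g (m • u) := by
  have h : ∀ v, Ibox d m v * g v = (cube d m).indicator (fun v => (m ^ d)⁻¹ * g v) v := by
    intro v
    rw [Ibox_eq_indicator, Set.indicator_mul_left]
  simp only [h]
  rw [integral_indicator (measurableSet_cube d m), integral_const_mul, setIntegral_cube_eq d hm,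
    inv_mul_cancel_left₀ (by positivity)]

/-- The part of the Riesz kernel `‖·‖ ^ (-β)` inside the unit ball. -/
noncomputable def localRiesz (d : ℕ) (β : ℝ) : EuclideanSpace ℝ (Fin d) → ℝ :=
  (Metric.ball 0 1).indicator fun y => ‖y‖ ^ (-β)

lemma integrable_localRiesz {d : ℕ} (hd : 1 ≤ d) {β : ℝ} (hβ : β < 1) :
    Integrable (localRiesz d β) :=
  (integrable_indicator_iff measurableSet_ball).2 (integrableOn_ball_norm_rpow_neg hd hβ 1)

lemma localRiesz_nonneg (d : ℕ) (β : ℝ) (x : EuclideanSpace ℝ (Fin d)) :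
    0 ≤ localRiesz d β x :=
  Set.indicator_nonneg (fun _ _ => by positivity) x

lemma norm_rpow_neg_le (d : ℕ) {β : ℝ} (hβ : 0 ≤ β) (x : EuclideanSpace ℝ (Fin d)) :
    ‖x‖ ^ (-β) ≤ 1 + localRiesz d β x := by
  by_cases hx : x ∈ Metric.ball (0 : EuclideanSpace ℝ (Fin d)) 1
  · simp [localRiesz, Set.indicator_of_mem hx]
  · have h : 1 ≤ ‖x‖ := by simpa using hx
    simpa [localRiesz, Set.indicator_of_notMem hx] using
      Real.rpow_le_one_of_one_le_of_nonpos h (by linarith)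

lemma exists_setIntegral_norm_smul_sub_rpow_le {d : ℕ} (hd : 1 ≤ d) {β : ℝ}
    (hβ : β ∈ Set.Ioo (0 : ℝ) 1) {m : ℝ} (hm : 0 < m) :
    ∃ C : ℝ, ∀ a : EuclideanSpace ℝ (Fin d),
      IntegrableOn (fun u => ‖m • u - a‖ ^ (-β)) (cube d 1) ∧
      ∫ u in cube d 1, ‖m • u - a‖ ^ (-β) ≤ C := by
  refine ⟨volume.real (cube d 1) + (m ^ d)⁻¹ * ∫ y, localRiesz d β y, fun a => ?_⟩
  have hg : Integrable fun u => localRiesz d β (m • u - a) :=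
    ((integrable_localRiesz hd hβ.2).comp_sub_right a).comp_smul hm.ne'
  have h1 : IntegrableOn (fun _ => (1 : ℝ)) (cube d 1) :=
    integrableOn_const (volume_cube_lt_top d 1).ne
  have hle : ∀ u, ‖m • u - a‖ ^ (-β) ≤ 1 + localRiesz d β (m • u - a) :=
    fun u => norm_rpow_neg_le d hβ.1.le _
  have hI : IntegrableOn (fun u => ‖m • u - a‖ ^ (-β)) (cube d 1) := by
    refine (h1.add hg.integrableOn).mono' (Measurable.aestronglyMeasurable (by fun_prop))
      (ae_of_all _ fun u => ?_)
    rw [Real.norm_of_nonneg (by positivity)]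
    exact hle u
  refine ⟨hI, (integral_mono hI (h1.add hg.integrableOn) hle).trans ?_⟩
  simp only [Pi.add_apply]
  rw [integral_add h1 hg.integrableOn]
  refine add_le_add (by simp) ((setIntegral_le_integral hg
    (ae_of_all _ fun u => localRiesz_nonneg d β _)).trans_eq ?_)
  rw [Measure.integral_comp_smul_of_nonneg volume (fun z => localRiesz d β (z - a)) m (hR := hm.le),
    integral_sub_right_eq_self (localRiesz d β) a, finrank_euclideanSpace, Fintype.card_fin,
    smul_eq_mul]

lemma integral_convE_mul_norm_rpow {d : ℕ} (hd : 1 ≤ d) {β : ℝ} (hβ : β ∈ Set.Ioo (0 : ℝ) 1)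
    {a b : ℝ} (ha : 0 < a) (hb : 0 < b) :
    ∫ z : EuclideanSpace ℝ (Fin d), convE d (Ibox d b) (IboxTilde d a) z * ‖z‖ ^ (-β) =
      ∫ u₁ in cube d 1, ∫ u₂ in cube d 1, ‖b • u₂ - a • u₁‖ ^ (-β) := by
  have hT : Integrable (IboxTilde d a) := (integrable_Ibox d a).comp_neg
  have hTnn : ∀ y, 0 ≤ IboxTilde d a y := fun y => Ibox_nonneg d ha.le _
  have hconv : Integrable (fun p : EuclideanSpace ℝ (Fin d) × EuclideanSpace ℝ (Fin d) =>
      IboxTilde d a p.2 * Ibox d b (p.1 - p.2)) (volume.prod volume) :=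
    hT.convolution_integrand (ContinuousLinearMap.mul ℝ ℝ) (integrable_Ibox d b)
  have hint : Integrable (fun p : EuclideanSpace ℝ (Fin d) × EuclideanSpace ℝ (Fin d) =>
      IboxTilde d a p.2 * Ibox d b (p.1 - p.2) * ‖p.1‖ ^ (-β)) (volume.prod volume) := by
    refine (hconv.add (((integrable_localRiesz hd hβ.2).mul_prod hT).const_mul
      (b ^ d)⁻¹)).mono' (hconv.aestronglyMeasurable.mul
        (Measurable.aestronglyMeasurable (by fun_prop))) (ae_of_all _ fun p => ?_)
    have h1 := mul_nonneg (hTnn p.2) (Ibox_nonneg d hb.le (p.1 - p.2))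
    rw [Real.norm_of_nonneg (mul_nonneg h1 (by positivity))]
    refine (mul_le_mul_of_nonneg_left (norm_rpow_neg_le d hβ.1.le p.1) h1).trans ?_
    rw [mul_add, mul_one]
    refine add_le_add le_rfl ?_
    calc _ = Ibox d b (p.1 - p.2) * (localRiesz d β p.1 * IboxTilde d a p.2) := by ring
      _ ≤ _ := mul_le_mul_of_nonneg_right (Ibox_le d hb.le _)
        (mul_nonneg (localRiesz_nonneg d β _) (hTnn _))
  calc _ = ∫ z : EuclideanSpace ℝ (Fin d), ∫ y : EuclideanSpace ℝ (Fin d),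
        IboxTilde d a y * Ibox d b (z - y) * ‖z‖ ^ (-β) := by
        refine integral_congr_ae (ae_of_all _ fun z => ?_)
        simp only [convE]
        rw [← integral_mul_const]
        simp only [mul_comm (IboxTilde d a _)]
    _ = ∫ y : EuclideanSpace ℝ (Fin d), ∫ z : EuclideanSpace ℝ (Fin d),
        IboxTilde d a y * Ibox d b (z - y) * ‖z‖ ^ (-β) := integral_integral_swap hint
    _ = ∫ y : EuclideanSpace ℝ (Fin d), IboxTilde d a y *
        ∫ u in cube d 1, ‖b • u + y‖ ^ (-β) := by
        refine integral_congr_ae (ae_of_all _ fun y => ?_)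
        simp only [mul_assoc]
        rw [integral_const_mul, ← integral_add_right_eq_self _ y]
        simp only [add_sub_cancel_right]
        rw [integral_Ibox_mul d hb fun v => ‖v + y‖ ^ (-β)]
    _ = ∫ y : EuclideanSpace ℝ (Fin d), Ibox d a y *
        ∫ u in cube d 1, ‖b • u - y‖ ^ (-β) := by
        rw [← integral_neg_eq_self]
        simp only [IboxTilde, neg_neg, sub_eq_add_neg]
    _ = _ := integral_Ibox_mul d ha fun y => ∫ u in cube d 1, ‖b • u - y‖ ^ (-β)

lemma tendsto_integral_cube_integral_cube {d : ℕ} (hd : 1 ≤ d) {β : ℝ}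
    (hβ : β ∈ Set.Ioo (0 : ℝ) 1) (a : ℝ) {b : ℝ} (hb : 0 < b)
    {Φ : ℝ → EuclideanSpace ℝ (Fin d) → ℝ} (hΦ : ∀ N, Measurable (Φ N)) {C L : ℝ}
    (hbound : ∀ N, 0 < N → ∀ x, x ≠ 0 → ‖Φ N x‖ ≤ C * ‖x‖ ^ (-β))
    (hlim : ∀ x, x ≠ 0 →
      Filter.Tendsto (fun N => Φ N x) Filter.atTop (nhds (L * ‖x‖ ^ (-β)))) :
    Filter.Tendsto
      (fun N => ∫ u₁ in cube d 1, ∫ u₂ in cube d 1, Φ N (b • u₂ - a • u₁)) Filter.atTop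
      (nhds (L * ∫ u₁ in cube d 1, ∫ u₂ in cube d 1, ‖b • u₂ - a • u₁‖ ^ (-β))) := by
  have : Nonempty (Fin d) := ⟨⟨0, hd⟩⟩
  obtain ⟨K, hK⟩ := exists_setIntegral_norm_smul_sub_rpow_le hd hβ hb
  have hC : 0 ≤ C := by
    obtain ⟨x, hx⟩ := exists_ne (0 : EuclideanSpace ℝ (Fin d))
    exact nonneg_of_mul_nonneg_left ((norm_nonneg _).trans (hbound 1 one_pos x hx))
      (Real.rpow_pos_of_pos (norm_pos_iff.2 hx) _)
  have hne : ∀ y : EuclideanSpace ℝ (Fin d), ∀ᵐ u ∂volume.restrict (cube d 1), b • u - y ≠ 0 := by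
    intro y
    refine ae_restrict_of_ae ?_
    filter_upwards [Measure.ae_ne volume (b⁻¹ • y)] with u hu h
    apply hu
    rw [← sub_eq_zero.1 h, smul_smul, inv_mul_cancel₀ hb.ne', one_smul]
  have hfin : IsFiniteMeasure (volume.restrict (cube d 1)) :=
    isFiniteMeasure_restrict.2 (volume_cube_lt_top d 1).ne
  rw [← integral_const_mul]
  refine tendsto_integral_filter_of_dominated_convergence (fun _ => C * K) ?_ ?_
    (integrable_const _) (ae_of_all _ fun u₁ => ?_)
  · refine Filter.Eventually.of_forall fun N => ?_
    have h : Measurable fun p : EuclideanSpace ℝ (Fin d) × EuclideanSpace ℝ (Fin d) =>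
        Φ N (b • p.2 - a • p.1) := (hΦ N).comp (by fun_prop)
    exact h.stronglyMeasurable.integral_prod_right'.aestronglyMeasurable
  · filter_upwards [Filter.eventually_gt_atTop 0] with N hN
    refine ae_of_all _ fun u₁ => ?_
    refine (norm_integral_le_of_norm_le ((hK (a • u₁)).1.const_mul C) ?_).trans ?_
    · filter_upwards [hne (a • u₁)] with u₂ hu
      exact hbound N hN _ hu
    · rw [integral_const_mul]
      exact mul_le_mul_of_nonneg_left (hK _).2 hC
  · rw [← integral_const_mul]
    refine tendsto_integral_filter_of_dominated_convergence
      (fun u₂ => C * ‖b • u₂ - a • u₁‖ ^ (-β)) ?_ ?_ ((hK (a • u₁)).1.const_mul C) ?_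
    · exact Filter.Eventually.of_forall fun N =>
        ((hΦ N).comp (by fun_prop)).aestronglyMeasurable
    · filter_upwards [Filter.eventually_gt_atTop 0] with N hN
      filter_upwards [hne (a • u₁)] with u₂ hu
      exact hbound N hN _ hu
    · filter_upwards [hne (a • u₁)] with u₂ hu
      exact hlim _ hu

/-- The time integral of the rescaled heat semigroup applied to the Riesz kernel, along the
bridge `s ↦ (s / τ) • x` with variance `2 s (τ - s) / τ`. -/
noncomputable def bridgeRiesz (d : ℕ) (β τ t N : ℝ) (x : EuclideanSpace ℝ (Fin d)) : ℝ :=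
  ∫ s in Set.Ioo 0 t, N ^ β * heatRiesz d β (2 * s * (τ - s) / τ) (N • (s / τ) • x)

lemma measurable_bridgeRiesz (d : ℕ) (β τ t N : ℝ) : Measurable (bridgeRiesz d β τ t N) := by
  have h : Measurable fun p : EuclideanSpace ℝ (Fin d) × ℝ =>
      N ^ β * heatRiesz d β (2 * p.2 * (τ - p.2) / τ) (N • (p.2 / τ) • p.1) :=
    ((measurable_heatRiesz d β).comp
      (f := fun p : EuclideanSpace ℝ (Fin d) × ℝ =>
        (2 * p.2 * (τ - p.2) / τ, N • (p.2 / τ) • p.1)) (by fun_prop)).const_mul _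
  exact h.stronglyMeasurable.integral_prod_right'.measurable

lemma integrableOn_div_rpow_neg {β τ t : ℝ} (hβ : β < 1) (hτ : 0 < τ) (ht : 0 < t) :
    IntegrableOn (fun s : ℝ => (s / τ) ^ (-β)) (Set.Ioo 0 t) ∧
      ∫ s in Set.Ioo 0 t, (s / τ) ^ (-β) = t ^ (1 - β) * τ ^ β / (1 - β) := by
  have heq : Set.EqOn (fun s : ℝ => τ ^ β * s ^ (-β)) (fun s => (s / τ) ^ (-β)) (Set.Ioo 0 t) := by
    intro s hs
    simp only
    rw [Real.div_rpow hs.1.le hτ.le, Real.rpow_neg hτ.le, div_inv_eq_mul, mul_comm]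
  have hI : IntervalIntegrable (fun s : ℝ => s ^ (-β)) volume 0 t :=
    intervalIntegral.intervalIntegrable_rpow' (by linarith)
  rw [intervalIntegrable_iff_integrableOn_Ioo_of_le ht.le] at hI
  refine ⟨IntegrableOn.congr_fun (hI.const_mul _) heq measurableSet_Ioo, ?_⟩
  rw [← setIntegral_congr_fun measurableSet_Ioo heq, integral_const_mul,
    ← integral_Ioc_eq_integral_Ioo, ← intervalIntegral.integral_of_le ht.le,
    integral_rpow (Or.inl (by linarith)), Real.zero_rpow (by linarith),
    show -β + 1 = 1 - β by ring]
  ring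

lemma exists_norm_rpow_mul_heatRiesz_le {d : ℕ} (hd : 1 ≤ d) {β : ℝ}
    (hβ : β ∈ Set.Ioo (0 : ℝ) 1) {τ t : ℝ} (hτ : 0 < τ) (htτ : t ≤ τ) :
    ∃ C : ℝ, ∀ N, 0 < N → ∀ x : EuclideanSpace ℝ (Fin d), x ≠ 0 → ∀ s ∈ Set.Ioo 0 t,
      ‖N ^ β * heatRiesz d β (2 * s * (τ - s) / τ) (N • (s / τ) • x)‖ ≤
        C * ‖x‖ ^ (-β) * (s / τ) ^ (-β) := by
  obtain ⟨C, -, hC⟩ := exists_heatRiesz_le hd hβ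
  refine ⟨C, fun N hN x hx s hs => ?_⟩
  have hs0 : 0 < s := hs.1
  have hsτ : 0 < τ - s := by linarith [hs.2]
  have hσ : 0 < 2 * s * (τ - s) / τ := by positivity
  have hle := hC _ hσ (N • (s / τ) • x)
    (smul_ne_zero hN.ne' (smul_ne_zero (by positivity) hx))
  rw [Real.norm_of_nonneg (mul_nonneg (by positivity) (heatRiesz_nonneg d β hσ.le _))]
  refine (mul_le_mul_of_nonneg_left hle (by positivity)).trans_eq ?_
  have hN' : N ^ β * N ^ (-β) = 1 := by rw [← Real.rpow_add hN, add_neg_cancel, Real.rpow_zero]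
  rw [norm_smul, norm_smul, Real.norm_of_nonneg hN.le, Real.norm_of_nonneg (by positivity),
    Real.mul_rpow hN.le (by positivity), Real.mul_rpow (by positivity) (norm_nonneg _)]
  linear_combination (C * (s / τ) ^ (-β) * ‖x‖ ^ (-β)) * hN'

lemma exists_norm_bridgeRiesz_le {d : ℕ} (hd : 1 ≤ d) {β : ℝ}
    (hβ : β ∈ Set.Ioo (0 : ℝ) 1) {τ t : ℝ} (ht : 0 < t) (htτ : t ≤ τ) :
    ∃ C : ℝ, ∀ N, 0 < N → ∀ x : EuclideanSpace ℝ (Fin d), x ≠ 0 →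
      ‖bridgeRiesz d β τ t N x‖ ≤ C * ‖x‖ ^ (-β) := by
  have hτ := ht.trans_le htτ
  obtain ⟨C, hC⟩ := exists_norm_rpow_mul_heatRiesz_le hd hβ hτ htτ
  refine ⟨C * ∫ s in Set.Ioo 0 t, (s / τ) ^ (-β), fun N hN x hx => ?_⟩
  refine (norm_integral_le_of_norm_le
    ((integrableOn_div_rpow_neg hβ.2 hτ ht).1.const_mul (C * ‖x‖ ^ (-β))) ?_).trans_eq ?_
  · exact (ae_restrict_iff' measurableSet_Ioo).2 (ae_of_all _ fun s hs => hC N hN x hx s hs)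
  · rw [integral_const_mul]
    ring

lemma tendsto_bridgeRiesz {d : ℕ} (hd : 1 ≤ d) {β : ℝ}
    (hβ : β ∈ Set.Ioo (0 : ℝ) 1) {τ t : ℝ} (ht : 0 < t) (htτ : t ≤ τ)
    {x : EuclideanSpace ℝ (Fin d)} (hx : x ≠ 0) :
    Filter.Tendsto (fun N => bridgeRiesz d β τ t N x) Filter.atTop
      (nhds (t ^ (1 - β) * τ ^ β / (1 - β) * ‖x‖ ^ (-β))) := by
  have hτ := ht.trans_le htτ
  obtain ⟨C, hC⟩ := exists_norm_rpow_mul_heatRiesz_le hd hβ hτ htτ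
  obtain ⟨hI, hval⟩ := integrableOn_div_rpow_neg hβ.2 hτ ht
  rw [← hval, ← integral_mul_const]
  refine tendsto_integral_filter_of_dominated_convergence
    (fun s => C * ‖x‖ ^ (-β) * (s / τ) ^ (-β)) ?_ ?_ (hI.const_mul _) ?_
  · refine Filter.Eventually.of_forall fun N => Measurable.aestronglyMeasurable ?_
    exact ((measurable_heatRiesz d β).comp
      (f := fun s : ℝ => (2 * s * (τ - s) / τ, N • (s / τ) • x)) (by fun_prop)).const_mul _
  · filter_upwards [Filter.eventually_gt_atTop 0] with N hN
    exact (ae_restrict_iff' measurableSet_Ioo).2 (ae_of_all _ fun s hs => hC N hN x hx s hs)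
  · refine (ae_restrict_iff' measurableSet_Ioo).2 (ae_of_all _ fun s hs => ?_)
    have hs0 : 0 < s := hs.1
    have hsτ : 0 < τ - s := by linarith [hs.2]
    have h := tendsto_rpow_mul_heatRiesz_smul hd hβ
      (by positivity : 0 < 2 * s * (τ - s) / τ)
      (smul_ne_zero (by positivity : s / τ ≠ 0) hx)
    rwa [norm_smul, Real.norm_of_nonneg (by positivity),
      Real.mul_rpow (by positivity) (norm_nonneg _)] at h

lemma rpow_mul_VNriesz (d : ℕ) (β t₁ t₂ : ℝ) {N : ℝ} (hN : 0 < N) :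
    N ^ β * VNriesz d β t₁ t₂ N =
      ∫ u₁ in cube d 1, ∫ u₂ in cube d 1,
        bridgeRiesz d β (2 * t₁ * t₂ / (t₁ + t₂)) t₁ N
          ((2 * t₁ / (t₁ + t₂)) • u₂ - (2 * t₂ / (t₁ + t₂)) • u₁) := by
  change N ^ β * ((N ^ (2 * d))⁻¹ * ∫ x₁ in cube d N, ∫ x₂ in cube d N,
    ∫ s in Set.Ioo (0 : ℝ) t₁, heatRiesz d β
      (2 * s * (2 * t₁ * t₂ / (t₁ + t₂) - s) / (2 * t₁ * t₂ / (t₁ + t₂)))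
      ((s / (2 * t₁ * t₂ / (t₁ + t₂))) •
        ((2 * t₁ / (t₁ + t₂)) • x₂ - (2 * t₂ / (t₁ + t₂)) • x₁))) = _
  have harg : ∀ (c p q : ℝ) (u₁ u₂ : EuclideanSpace ℝ (Fin d)),
      c • (p • N • u₂ - q • N • u₁) = N • c • (p • u₂ - q • u₁) := by
    intro c p q u₁ u₂
    module
  have hN' : (N ^ (2 * d))⁻¹ * (N ^ d * N ^ d) = 1 := by
    rw [← pow_add, ← two_mul, inv_mul_cancel₀ (by positivity)]
  simp only [setIntegral_cube_eq d hN, bridgeRiesz, integral_const_mul, harg]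
  linear_combination (N ^ β * ∫ u₁ in cube d 1, ∫ u₂ in cube d 1, ∫ s in Set.Ioo (0 : ℝ) t₁,
    heatRiesz d β (2 * s * (2 * t₁ * t₂ / (t₁ + t₂) - s) / (2 * t₁ * t₂ / (t₁ + t₂)))
      (N • (s / (2 * t₁ * t₂ / (t₁ + t₂))) •
        ((2 * t₁ / (t₁ + t₂)) • u₂ - (2 * t₂ / (t₁ + t₂)) • u₁))) * hN'

/-- For `d ≥ 1`, `β ∈ (0,1)`, `0 < t₁ ≤ t₂`,
`lim_{N→∞} N^β V_N = (t₁^{1-β} τ^β / (1-β)) ∫ (I_{τ₂} ⋆ Ĩ_{τ₁})(z) ‖z‖^{-β} dz`. -/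
theorem stmt_12 (d : ℕ) (hd : 1 ≤ d) (β : ℝ) (hβ : β ∈ Set.Ioo (0 : ℝ) 1)
    (t₁ t₂ τ τ₁ τ₂ : ℝ) (h1 : 0 < t₁) (h12 : t₁ ≤ t₂)
    (hτ : τ = 2 * t₁ * t₂ / (t₁ + t₂)) (hτ₁ : τ₁ = 2 * t₂ / (t₁ + t₂))
    (hτ₂ : τ₂ = 2 * t₁ / (t₁ + t₂)) :
    Filter.Tendsto (fun N : ℝ => N ^ β * VNriesz d β t₁ t₂ N) Filter.atTop
      (nhds ((t₁ ^ (1 - β) * τ ^ β / (1 - β)) *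
        ∫ z : EuclideanSpace ℝ (Fin d),
          convE d (Ibox d τ₂) (IboxTilde d τ₁) z * ‖z‖ ^ (-β))) := by
  have h2 : 0 < t₂ := h1.trans_le h12
  have hτ₁pos : 0 < τ₁ := by rw [hτ₁]; positivity
  have hτ₂pos : 0 < τ₂ := by rw [hτ₂]; positivity
  have ht : t₁ ≤ τ := by
    rw [hτ, le_div_iff₀ (by positivity)]
    nlinarith
  obtain ⟨C, hC⟩ := exists_norm_bridgeRiesz_le hd hβ h1 ht
  have hlim := tendsto_integral_cube_integral_cube hd hβ τ₁ hτ₂pos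
    (measurable_bridgeRiesz d β τ t₁) hC fun x hx => tendsto_bridgeRiesz hd hβ h1 ht hx
  rw [integral_convE_mul_norm_rpow hd hβ hτ₁pos hτ₂pos]
  refine hlim.congr' ?_
  filter_upwards [Filter.eventually_gt_atTop 0] with N hN
  rw [rpow_mul_VNriesz d β t₁ t₂ hN, hτ, hτ₁, hτ₂]
end
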